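/- Let W be a type, S a subset of W, and f, g : W → [0,1]. Set a = ⨆_{w ∈ S} f w and b = ⨆_{w ∈ S} g w. Then ((b ⇒ a) ⇒ a) ≤ ⨆_{w ∈ S} ((g w ⇒ f w) ⇒ f w). (This is validity of the formula (T^<_◇): ((◇ψ → ◇φ) → ◇φ) → ◇((ψ → φ) → φ) at any world of any crisp Gödel-Kripke model.) -/

import Mathlib

open unitInterval

instance : Fact ((0:ℝ) ≤ 1) := ⟨zero_le_one⟩

noncomputable instance : CompleteLattice unitInterval := Set.Icc.completeLattice

/-- Gödel implication on the unit interval. -/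
noncomputable def gimp (a b : unitInterval) : unitInterval := if a ≤ b then 1 else b

infixr:60 " ⇒ " => gimp

/-- Gödel negation on the unit interval. -/
noncomputable def gneg (a : unitInterval) : unitInterval := a ⇒ 0

theorem le_gimp (x y : unitInterval) : y ≤ (x ⇒ y) := by
  unfold gimp
  split_ifs
  · exact y.2.2
  · exact le_rfl

theorem gimp_of_le {x y : unitInterval} (h : x ≤ y) : (x ⇒ y) = 1 := if_pos h

theorem gimp_of_not_le {x y : unitInterval} (h : ¬ x ≤ y) : (x ⇒ y) = y := if_neg h

theorem one_gimp (y : unitInterval) : (1 ⇒ y) = y := by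
  by_cases h : 1 ≤ y
  · rw [gimp_of_le h]
    exact le_antisymm h y.2.2
  · exact gimp_of_not_le h

theorem validity_Tlt_diamond {W : Type*} (S : Set W) (f g : W → unitInterval)
    (a b : unitInterval)
    (ha : a = ⨆ w ∈ S, f w) (hb : b = ⨆ w ∈ S, g w) :
    ((b ⇒ a) ⇒ a) ≤ ⨆ w ∈ S, ((g w ⇒ f w) ⇒ f w) := by
  by_cases hba : b ≤ a
  · rw [gimp_of_le hba, one_gimp, ha]
    exact iSup₂_mono fun w _ => le_gimp _ (f w)
  · obtain ⟨w, hw, hgw⟩ : ∃ w ∈ S, ¬ g w ≤ a := by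
      by_contra! h
      exact hba (hb.trans_le (iSup₂_le h))
    have hfw : f w ≤ a := (le_iSup₂ (f := fun w (_ : w ∈ S) => f w) w hw).trans_eq ha.symm
    have hgf : ¬ g w ≤ f w := fun h => hgw (h.trans hfw)
    have htop : ((g w ⇒ f w) ⇒ f w) = 1 := by
      rw [gimp_of_not_le hgf, gimp_of_le le_rfl]
    rw [gimp_of_not_le hba, gimp_of_le le_rfl, ← htop]
    exact le_iSup₂ (f := fun w (_ : w ∈ S) => ((g w ⇒ f w) ⇒ f w)) w hw
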